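/- arXiv:2004.13112 — 2 statements merged into one kernel-verified Lean document; each statement's English description precedes it below -/
import Mathlib

section
/- Let L be the Lagrangian of the discretized optimal control problem (P^{D,N}) with multipliers Ψ_A, Ψ_d ∈ ℝ^{N+1}. Then the dual feasibility (stationarity) conditions ∂L/∂X_i = 0, ∂L/∂U_i = 0 and ∂L/∂V_i = 0 for all i = 0,…,N hold if and only if, setting the transformed multipliers Ψ̄_A := Q⁻¹Ψ_A and Ψ̄_d := Q⁻¹Ψ_d, the following three systems hold: (i) A_v† Ψ̄_A − Ψ̄_d = 0; (ii) ∂_x H(Ψ̄_{d,i}, X_i, U_i) + (A_x† Ψ̄_A)_i = 0 for all i; (iii) ∂_u H(Ψ̄_{d,i}, X_i, U_i) = 0 for all i. (This is Lemma 1 of the paper, in the boundary-condition-free case where the right-hand-side vector C^{*N} is zero.) -/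
open Matrix Function BigOperators

/-- The Q-adjoint `M† := Q⁻¹ Mᵀ Q` with `Q = diag q`. -/
noncomputable def Qadj {N : ℕ} (q : Fin (N+1) → ℝ) (M : Matrix (Fin (N+1)) (Fin (N+1)) ℝ) :
    Matrix (Fin (N+1)) (Fin (N+1)) ℝ :=
  (Matrix.diagonal q)⁻¹ * Mᵀ * Matrix.diagonal q

/-- The Hamiltonian `H(λ, x, u) := F(x,u) + λ·f(x,u)`. -/
noncomputable def Ham (F f : ℝ → ℝ → ℝ) (lam x u : ℝ) : ℝ := F x u + lam * f x u

/-- Partial derivative of the Hamiltonian in `x`. -/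
noncomputable def Hx (F f : ℝ → ℝ → ℝ) (lam x u : ℝ) : ℝ :=
  deriv (fun s => Ham F f lam s u) x

/-- Partial derivative of the Hamiltonian in `u`. -/
noncomputable def Hu (F f : ℝ → ℝ → ℝ) (lam x u : ℝ) : ℝ :=
  deriv (fun s => Ham F f lam x s) u

/-- Lagrangian of the discretized problem `(P^{D,N})`. -/
noncomputable def Lag {N : ℕ} (q : Fin (N+1) → ℝ) (F f : ℝ → ℝ → ℝ)
    (Ax Av : Matrix (Fin (N+1)) (Fin (N+1)) ℝ) (C : Fin (N+1) → ℝ)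
    (X U V ΨA Ψd : Fin (N+1) → ℝ) : ℝ :=
  (∑ i, q i * F (X i) (U i))
    + (∑ i, ΨA i * (Ax *ᵥ X + Av *ᵥ V - C) i)
    + (∑ i, Ψd i * (f (X i) (U i) - V i))

theorem sumderiv_aux {n : ℕ} (G : Fin n → ℝ → ℝ) (X : Fin n → ℝ) (i : Fin n) (d : ℝ)
    (h : HasDerivAt (G i) d (X i)) :
    HasDerivAt (fun s => ∑ j, G j (update X i s j)) d (X i) := by
  have e : (fun s => ∑ j, G j (update X i s j))
      = fun s => G i s + ∑ j ∈ Finset.univ.erase i, G j (X j) := by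
    funext s
    rw [← Finset.add_sum_erase _ _ (Finset.mem_univ i)]
    congr 1
    · simp
    · refine Finset.sum_congr rfl fun j hj => ?_
      rw [update_of_ne (Finset.ne_of_mem_erase hj)]
  rw [e]
  exact h.add_const _

theorem Lag_eq_aux {N : ℕ} (q : Fin (N+1) → ℝ) (F f : ℝ → ℝ → ℝ)
    (Ax Av : Matrix (Fin (N+1)) (Fin (N+1)) ℝ) (C : Fin (N+1) → ℝ)
    (X U V ΨA Ψd : Fin (N+1) → ℝ) :
    Lag q F f Ax Av C X U V ΨA Ψd = ∑ j, (q j * F (X j) (U j) + (Axᵀ *ᵥ ΨA) j * X j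
      + (Avᵀ *ᵥ ΨA) j * V j - ΨA j * C j + Ψd j * (f (X j) (U j) - V j)) := by
  have key : ∀ (A : Matrix (Fin (N+1)) (Fin (N+1)) ℝ) (Y : Fin (N+1) → ℝ),
      ∑ j, (Aᵀ *ᵥ ΨA) j * Y j = ∑ j, ΨA j * (A *ᵥ Y) j := by
    intro A Y
    have := Matrix.dotProduct_mulVec ΨA A Y
    rw [← Matrix.mulVec_transpose] at this
    exact this.symm
  simp only [Lag, Finset.sum_add_distrib, Finset.sum_sub_distrib, key, Pi.add_apply, Pi.sub_apply,
    mul_add, mul_sub]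
  ring

theorem dinv_aux {N : ℕ} (q : Fin (N+1) → ℝ) (hq : ∀ i, 0 < q i) :
    (Matrix.diagonal q)⁻¹ = Matrix.diagonal (fun i => (q i)⁻¹) := by
  apply Matrix.inv_eq_right_inv
  rw [Matrix.diagonal_mul_diagonal, ← Matrix.diagonal_one]
  congr 1
  funext i
  exact mul_inv_cancel₀ (hq i).ne'

theorem Qadj_aux {N : ℕ} (q : Fin (N+1) → ℝ) (hq : ∀ i, 0 < q i)
    (A : Matrix (Fin (N+1)) (Fin (N+1)) ℝ) (Y : Fin (N+1) → ℝ) (i : Fin (N+1)) :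
    (Qadj q A *ᵥ ((Matrix.diagonal q)⁻¹ *ᵥ Y)) i = (q i)⁻¹ * (Aᵀ *ᵥ Y) i := by
  have h : Matrix.diagonal q *ᵥ (Matrix.diagonal (fun i => (q i)⁻¹) *ᵥ Y) = Y := by
    funext j
    rw [Matrix.mulVec_diagonal, Matrix.mulVec_diagonal, mul_inv_cancel_left₀ (hq j).ne']
  rw [Qadj, dinv_aux q hq, ← Matrix.mulVec_mulVec, h, ← Matrix.mulVec_mulVec,
    Matrix.mulVec_diagonal]

/-- Lemma 1 (boundary-condition-free case): dual feasibility (stationarity of the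
Lagrangian of `(P^{D,N})` in `X`, `U`, `V`) holds iff, with the transformed multipliers
`Ψ̄_A := Q⁻¹Ψ_A` and `Ψ̄_d := Q⁻¹Ψ_d`, one has `A_v† Ψ̄_A − Ψ̄_d = 0`,
`∂_x H(Ψ̄_{d,i}, X_i, U_i) + (A_x† Ψ̄_A)_i = 0` and `∂_u H(Ψ̄_{d,i}, X_i, U_i) = 0`. -/
theorem dido_lemma_one (N : ℕ) (q : Fin (N+1) → ℝ) (hq : ∀ i, 0 < q i)
    (F f : ℝ → ℝ → ℝ)
    (hF : Differentiable ℝ (fun p : ℝ × ℝ => F p.1 p.2))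
    (hf : Differentiable ℝ (fun p : ℝ × ℝ => f p.1 p.2))
    (Ax Av : Matrix (Fin (N+1)) (Fin (N+1)) ℝ) (C : Fin (N+1) → ℝ)
    (X U V ΨA Ψd : Fin (N+1) → ℝ) :
    ((∀ i, deriv (fun s => Lag q F f Ax Av C (update X i s) U V ΨA Ψd) (X i) = 0) ∧
     (∀ i, deriv (fun s => Lag q F f Ax Av C X (update U i s) V ΨA Ψd) (U i) = 0) ∧
     (∀ i, deriv (fun s => Lag q F f Ax Av C X U (update V i s) ΨA Ψd) (V i) = 0)) ↔
    (Qadj q Av *ᵥ ((Matrix.diagonal q)⁻¹ *ᵥ ΨA) - (Matrix.diagonal q)⁻¹ *ᵥ Ψd = 0 ∧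
     (∀ i, Hx F f (((Matrix.diagonal q)⁻¹ *ᵥ Ψd) i) (X i) (U i)
        + (Qadj q Ax *ᵥ ((Matrix.diagonal q)⁻¹ *ᵥ ΨA)) i = 0) ∧
     (∀ i, Hu F f (((Matrix.diagonal q)⁻¹ *ᵥ Ψd) i) (X i) (U i) = 0)) := by
  have dq : ∀ i, ((Matrix.diagonal q)⁻¹ *ᵥ Ψd) i = (q i)⁻¹ * Ψd i := by
    intro i
    rw [dinv_aux q hq, Matrix.mulVec_diagonal]
  have x1 : ∀ (G : ℝ → ℝ → ℝ), Differentiable ℝ (fun p : ℝ × ℝ => G p.1 p.2) → ∀ x u,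
      HasDerivAt (fun s => G s u) (deriv (fun s => G s u) x) x := by
    intro G hG x u
    have : Differentiable ℝ (fun s => G s u) :=
      hG.comp (differentiable_id.prodMk (differentiable_const u))
    exact (this x).hasDerivAt
  have u1 : ∀ (G : ℝ → ℝ → ℝ), Differentiable ℝ (fun p : ℝ × ℝ => G p.1 p.2) → ∀ x u,
      HasDerivAt (fun s => G x s) (deriv (fun s => G x s) u) u := by
    intro G hG x u
    have : Differentiable ℝ (fun s => G x s) :=
      hG.comp ((differentiable_const x).prodMk differentiable_id)
    exact (this u).hasDerivAt
  have hx : ∀ l x u, Hx F f l x u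
      = deriv (fun s => F s u) x + l * deriv (fun s => f s u) x := fun l x u =>
    ((x1 F hF x u).add ((x1 f hf x u).const_mul l)).deriv
  have hu : ∀ l x u, Hu F f l x u
      = deriv (fun s => F x s) u + l * deriv (fun s => f x s) u := fun l x u =>
    ((u1 F hF x u).add ((u1 f hf x u).const_mul l)).deriv
  have LX : ∀ i, deriv (fun s => Lag q F f Ax Av C (update X i s) U V ΨA Ψd) (X i)
      = q i * (Hx F f (((Matrix.diagonal q)⁻¹ *ᵥ Ψd) i) (X i) (U i)
        + (Qadj q Ax *ᵥ ((Matrix.diagonal q)⁻¹ *ᵥ ΨA)) i) := by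
    intro i
    simp only [Lag_eq_aux]
    rw [(sumderiv_aux (fun j t => q j * F t (U j) + (Axᵀ *ᵥ ΨA) j * t
      + (Avᵀ *ᵥ ΨA) j * V j - ΨA j * C j + Ψd j * (f t (U j) - V j)) X i _
      ((((((x1 F hF (X i) (U i)).const_mul (q i)).add
        ((hasDerivAt_id (X i)).const_mul ((Axᵀ *ᵥ ΨA) i))).add_const _).sub_const _).add
        (((x1 f hf (X i) (U i)).sub_const (V i)).const_mul (Ψd i)))).deriv,
      hx, Qadj_aux q hq, dq]
    have := (hq i).ne'
    field_simp
    ring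
  have LU : ∀ i, deriv (fun s => Lag q F f Ax Av C X (update U i s) V ΨA Ψd) (U i)
      = q i * Hu F f (((Matrix.diagonal q)⁻¹ *ᵥ Ψd) i) (X i) (U i) := by
    intro i
    simp only [Lag_eq_aux]
    rw [(sumderiv_aux (fun j t => q j * F (X j) t + (Axᵀ *ᵥ ΨA) j * X j
      + (Avᵀ *ᵥ ΨA) j * V j - ΨA j * C j + Ψd j * (f (X j) t - V j)) U i _
      ((((((u1 F hF (X i) (U i)).const_mul (q i)).add_const _).add_const _).sub_const _).add
        (((u1 f hf (X i) (U i)).sub_const (V i)).const_mul (Ψd i)))).deriv,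
      hu, dq]
    have := (hq i).ne'
    field_simp
  have LV : ∀ i, deriv (fun s => Lag q F f Ax Av C X U (update V i s) ΨA Ψd) (V i)
      = q i * (Qadj q Av *ᵥ ((Matrix.diagonal q)⁻¹ *ᵥ ΨA)
        - (Matrix.diagonal q)⁻¹ *ᵥ Ψd) i := by
    intro i
    simp only [Lag_eq_aux]
    rw [(sumderiv_aux (fun j t => q j * F (X j) (U j) + (Axᵀ *ᵥ ΨA) j * X j
      + (Avᵀ *ᵥ ΨA) j * t - ΨA j * C j + Ψd j * (f (X j) (U j) - t)) V i _
      (((((hasDerivAt_id (V i)).const_mul ((Avᵀ *ᵥ ΨA) i)).const_add _).sub_const _).add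
        (((hasDerivAt_id (V i)).const_sub (f (X i) (U i))).const_mul (Ψd i)))).deriv,
      Pi.sub_apply, Qadj_aux q hq, dq]
    have := (hq i).ne'
    field_simp
    ring
  have z : ∀ i (a : ℝ), q i * a = 0 ↔ a = 0 := fun i a => by simp [(hq i).ne']
  simp only [LX, LU, LV, z]
  rw [funext_iff (f := _ - _)]
  simp only [Pi.zero_apply]
  tauto
end

section
/- Birkhoff pseudospectral discretizations satisfy the conditions of the Tunnel Theorem: if the discretization of ẋ = v is written in Birkhoff form A_x X + A_v V = C with A_x = −I and A_v = B for some matrix B ∈ ℝ^{(N+1)×(N+1)}, then with the choices A*_λ := −I and A*_ω := Q⁻¹BᵀQ the tunnel conditions A_x = −I, A*_λ = −I and A*_ω = A_v† all hold; consequently, every KKT point (X, U, V, Ψ_A, Ψ_d) of the discretized problem (P^{D,N}) yields, via Λ := Q⁻¹Ψ_d and Ω := Q⁻¹Ψ_A, a solution of the discretized primal-dual system (P^{λ,D,N}), and conversely. -/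
open Matrix Function BigOperators

theorem hasDerivAt_sum_update {n : ℕ} (g : Fin n → ℝ → ℝ) (X : Fin n → ℝ) (i : Fin n) (g' : ℝ)
    (h : HasDerivAt (g i) g' (X i)) :
    HasDerivAt (fun s => ∑ j, g j (update X i s j)) g' (X i) := by
  have e : (fun s => ∑ j, g j (update X i s j))
      = fun s => g i s + ∑ j ∈ Finset.univ.erase i, g j (X j) := by
    funext s
    rw [← Finset.add_sum_erase _ _ (Finset.mem_univ i)]
    congr 1
    · simp
    · refine Finset.sum_congr rfl fun j hj => ?_
      rw [update_of_ne (Finset.ne_of_mem_erase hj)]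
  rw [e]
  exact h.add_const _

theorem Lag_eq {N : ℕ} (q : Fin (N+1) → ℝ) (F f : ℝ → ℝ → ℝ)
    (B : Matrix (Fin (N+1)) (Fin (N+1)) ℝ) (C : Fin (N+1) → ℝ)
    (X U V ΨA Ψd : Fin (N+1) → ℝ) :
    Lag q F f (-1) B C X U V ΨA Ψd =
      ∑ j, (q j * F (X j) (U j) - ΨA j * X j + (Bᵀ *ᵥ ΨA) j * V j - ΨA j * C j
        + Ψd j * (f (X j) (U j) - V j)) := by
  have h : ∑ j, ΨA j * (B *ᵥ V) j = ∑ j, (Bᵀ *ᵥ ΨA) j * V j := by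
    have := Matrix.dotProduct_mulVec ΨA B V
    rw [← Matrix.mulVec_transpose] at this
    exact this
  have h2 : ∑ i, ΨA i * ((-1 : Matrix (Fin (N+1)) (Fin (N+1)) ℝ) *ᵥ X + B *ᵥ V - C) i
      = - ∑ j, ΨA j * X j + ∑ j, ΨA j * (B *ᵥ V) j - ∑ j, ΨA j * C j := by
    rw [← Finset.sum_neg_distrib, ← Finset.sum_add_distrib, ← Finset.sum_sub_distrib]
    refine Finset.sum_congr rfl fun j _ => ?_
    simp only [Matrix.neg_mulVec, Matrix.one_mulVec, Pi.add_apply, Pi.sub_apply, Pi.neg_apply]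
    ring
  unfold Lag
  rw [h2, h]
  simp only [Finset.sum_add_distrib, Finset.sum_sub_distrib]
  ring

/-- Birkhoff PS discretizations satisfy the tunnel theorem conditions: if `A_x = −I` and
`A_v = B`, then with `A*_λ := −I` and `A*_ω := Q⁻¹BᵀQ` the tunnel conditions `A_x = −I`,
`A*_λ = −I` and `A*_ω = A_v†` all hold; consequently every KKT point `(X,U,V,Ψ_A,Ψ_d)`
of `(P^{D,N})` yields, via `Λ := Q⁻¹Ψ_d`, `Ω := Q⁻¹Ψ_A`, a solution of the discretized
primal-dual system `(P^{λ,D,N})`, and conversely. -/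
theorem birkhoff_satisfies_tunnel (N : ℕ) (q : Fin (N+1) → ℝ) (hq : ∀ i, 0 < q i)
    (F f : ℝ → ℝ → ℝ)
    (hF : Differentiable ℝ (fun p : ℝ × ℝ => F p.1 p.2))
    (hf : Differentiable ℝ (fun p : ℝ × ℝ => f p.1 p.2))
    (Ax Av B : Matrix (Fin (N+1)) (Fin (N+1)) ℝ) (C : Fin (N+1) → ℝ)
    (hAx : Ax = -(1 : Matrix (Fin (N+1)) (Fin (N+1)) ℝ)) (hAv : Av = B)
    (X U V ΨA Ψd : Fin (N+1) → ℝ) :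
    (Ax = -(1 : Matrix (Fin (N+1)) (Fin (N+1)) ℝ) ∧
     (-(1 : Matrix (Fin (N+1)) (Fin (N+1)) ℝ)) = -(1 : Matrix (Fin (N+1)) (Fin (N+1)) ℝ) ∧
     (Matrix.diagonal q)⁻¹ * Bᵀ * Matrix.diagonal q = Qadj q Av) ∧
    ((Ax *ᵥ X + Av *ᵥ V = C ∧
      (∀ i, f (X i) (U i) - V i = 0) ∧
      (∀ i, deriv (fun s => Lag q F f Ax Av C (update X i s) U V ΨA Ψd) (X i) = 0) ∧
      (∀ i, deriv (fun s => Lag q F f Ax Av C X (update U i s) V ΨA Ψd) (U i) = 0) ∧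
      (∀ i, deriv (fun s => Lag q F f Ax Av C X U (update V i s) ΨA Ψd) (V i) = 0)) ↔
     (Ax *ᵥ X + Av *ᵥ V = C ∧
      (-(1 : Matrix (Fin (N+1)) (Fin (N+1)) ℝ)) *ᵥ ((Matrix.diagonal q)⁻¹ *ᵥ Ψd)
         + ((Matrix.diagonal q)⁻¹ * Bᵀ * Matrix.diagonal q) *ᵥ
             ((Matrix.diagonal q)⁻¹ *ᵥ ΨA) = 0 ∧
      (∀ i, f (X i) (U i) - V i = 0) ∧
      (∀ i, Hx F f (((Matrix.diagonal q)⁻¹ *ᵥ Ψd) i) (X i) (U i)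
         - ((Matrix.diagonal q)⁻¹ *ᵥ ΨA) i = 0) ∧
      (∀ i, Hu F f (((Matrix.diagonal q)⁻¹ *ᵥ Ψd) i) (X i) (U i) = 0))) := by
  subst hAx hAv
  refine ⟨⟨rfl, rfl, rfl⟩, ?_⟩
  have hq0 : ∀ i, q i ≠ 0 := fun i => (hq i).ne'
  have hinv : (Matrix.diagonal q)⁻¹ = Matrix.diagonal (fun i => (q i)⁻¹) := by
    apply Matrix.inv_eq_left_inv
    rw [Matrix.diagonal_mul_diagonal, ← Matrix.diagonal_one]
    congr 1
    funext i
    exact inv_mul_cancel₀ (hq0 i)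
  have hQQ : Matrix.diagonal q *ᵥ ((Matrix.diagonal q)⁻¹ *ᵥ ΨA) = ΨA := by
    funext i
    rw [hinv, Matrix.mulVec_diagonal, Matrix.mulVec_diagonal]
    exact mul_inv_cancel_left₀ (hq0 i) _
  have hadj : ((Matrix.diagonal q)⁻¹ * Avᵀ * Matrix.diagonal q) *ᵥ
      ((Matrix.diagonal q)⁻¹ *ᵥ ΨA) = (Matrix.diagonal q)⁻¹ *ᵥ (Avᵀ *ᵥ ΨA) := by
    rw [← Matrix.mulVec_mulVec, hQQ, Matrix.mulVec_mulVec]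
  have dx : ∀ G : ℝ → ℝ → ℝ, Differentiable ℝ (fun p : ℝ × ℝ => G p.1 p.2) → ∀ x u,
      HasDerivAt (fun s => G s u) (deriv (fun s => G s u) x) x := by
    intro G hG x u
    have : Differentiable ℝ (fun s : ℝ => G s u) :=
      hG.comp (differentiable_id.prodMk (differentiable_const u))
    exact (this x).hasDerivAt
  have du : ∀ G : ℝ → ℝ → ℝ, Differentiable ℝ (fun p : ℝ × ℝ => G p.1 p.2) → ∀ x u,
      HasDerivAt (fun s => G x s) (deriv (fun s => G x s) u) u := by
    intro G hG x u
    have : Differentiable ℝ (fun s : ℝ => G x s) :=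
      hG.comp ((differentiable_const x).prodMk differentiable_id)
    exact (this u).hasDerivAt
  have hX : ∀ i, deriv (fun s => Lag q F f (-1) Av C (update X i s) U V ΨA Ψd) (X i)
      = q i * (Hx F f (((Matrix.diagonal q)⁻¹ *ᵥ Ψd) i) (X i) (U i)
         - ((Matrix.diagonal q)⁻¹ *ᵥ ΨA) i) := by
    intro i
    simp only [Lag_eq]
    have a := dx F hF (X i) (U i)
    have b := dx f hf (X i) (U i)
    have key := hasDerivAt_sum_update (fun j s => q j * F s (U j) - ΨA j * s
      + (Avᵀ *ᵥ ΨA) j * V j - ΨA j * C j + Ψd j * (f s (U j) - V j)) X i _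
      (((((a.const_mul (q i)).sub ((hasDerivAt_id (X i)).const_mul (ΨA i))).add_const
        ((Avᵀ *ᵥ ΨA) i * V i)).sub_const (ΨA i * C i)).add
        ((b.sub_const (V i)).const_mul (Ψd i)))
    rw [key.deriv]
    have hh : Hx F f (((Matrix.diagonal q)⁻¹ *ᵥ Ψd) i) (X i) (U i) = _ :=
      (a.add (b.const_mul (((Matrix.diagonal q)⁻¹ *ᵥ Ψd) i))).deriv
    rw [hh, hinv, Matrix.mulVec_diagonal, Matrix.mulVec_diagonal]
    have := hq0 i
    field_simp
    ring
  have hU : ∀ i, deriv (fun s => Lag q F f (-1) Av C X (update U i s) V ΨA Ψd) (U i)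
      = q i * Hu F f (((Matrix.diagonal q)⁻¹ *ᵥ Ψd) i) (X i) (U i) := by
    intro i
    simp only [Lag_eq]
    have a := du F hF (X i) (U i)
    have b := du f hf (X i) (U i)
    have key := hasDerivAt_sum_update (fun j s => q j * F (X j) s - ΨA j * X j
      + (Avᵀ *ᵥ ΨA) j * V j - ΨA j * C j + Ψd j * (f (X j) s - V j)) U i _
      (((((a.const_mul (q i)).sub_const (ΨA i * X i)).add_const
        ((Avᵀ *ᵥ ΨA) i * V i)).sub_const (ΨA i * C i)).add
        ((b.sub_const (V i)).const_mul (Ψd i)))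
    rw [key.deriv]
    have hh : Hu F f (((Matrix.diagonal q)⁻¹ *ᵥ Ψd) i) (X i) (U i) = _ :=
      (a.add (b.const_mul (((Matrix.diagonal q)⁻¹ *ᵥ Ψd) i))).deriv
    rw [hh, hinv, Matrix.mulVec_diagonal]
    have := hq0 i
    field_simp
  have hV : ∀ i, deriv (fun s => Lag q F f (-1) Av C X U (update V i s) ΨA Ψd) (V i)
      = q i * ((-(1 : Matrix (Fin (N+1)) (Fin (N+1)) ℝ)) *ᵥ ((Matrix.diagonal q)⁻¹ *ᵥ Ψd)
         + ((Matrix.diagonal q)⁻¹ * Avᵀ * Matrix.diagonal q) *ᵥ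
             ((Matrix.diagonal q)⁻¹ *ᵥ ΨA)) i := by
    intro i
    simp only [Lag_eq]
    have key := hasDerivAt_sum_update (fun j s => q j * F (X j) (U j) - ΨA j * X j
      + (Avᵀ *ᵥ ΨA) j * s - ΨA j * C j + Ψd j * (f (X j) (U j) - s)) V i _
      (((((hasDerivAt_id (V i)).const_mul ((Avᵀ *ᵥ ΨA) i)).const_add
        (q i * F (X i) (U i) - ΨA i * X i)).sub_const (ΨA i * C i)).add
        (((hasDerivAt_id (V i)).const_sub (f (X i) (U i))).const_mul (Ψd i)))
    rw [key.deriv, hadj, hinv, Matrix.neg_mulVec, Matrix.one_mulVec, Pi.add_apply, Pi.neg_apply,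
      Matrix.mulVec_diagonal, Matrix.mulVec_diagonal]
    have := hq0 i
    field_simp
    ring
  simp only [hX, hU, hV, mul_eq_zero, hq0, false_or]
  constructor
  · rintro ⟨h1, h2, h3, h4, h5⟩
    exact ⟨h1, funext h5, h2, h3, h4⟩
  · rintro ⟨h1, h5, h2, h3, h4⟩
    exact ⟨h1, h2, h3, h4, fun i => congrFun h5 i⟩
end
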